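/- (Weyl's inequality.) Let k ≥ 2 be a natural number and let α ∈ ℝ^k. Suppose that a ∈ ℤ and q ∈ ℕ satisfy gcd(a,q) = 1 and |α_k − a/q| ≤ q^{−2}. Then for every ε > 0 there is a constant C(k,ε) such that for all real X ≥ 1 one has |f_k(α;X)| ≤ C(k,ε) · X^{1+ε} · ( q^{−1} + X^{−1} + q·X^{−k} )^{2^{1−k}}. -/

import Mathlib

/-- The Weyl sum `f k α X = ∑_{1 ≤ x ≤ X} e(α₁ x + … + α_k x^k)`, where the
`j`-th coordinate of `α : Fin k → ℝ` is the coefficient of `x^(j+1)`. -/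
noncomputable def fsum (k : ℕ) (α : Fin k → ℝ) (X : ℝ) : ℂ :=
  ∑ x ∈ Finset.Icc 1 ⌊X⌋₊,
    Complex.exp (2 * (Real.pi : ℂ) * Complex.I *
      ((∑ j : Fin k, α j * (x : ℝ) ^ ((j : ℕ) + 1) : ℝ) : ℂ))


noncomputable def ee (x : ℝ) : ℂ := Complex.exp (2 * (Real.pi : ℂ) * Complex.I * (x : ℂ))

lemma ee_add (x y : ℝ) : ee (x + y) = ee x * ee y := by
  unfold ee
  rw [← Complex.exp_add]; push_cast; ring_nf

lemma ee_norm (x : ℝ) : ‖ee x‖ = 1 := by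
  unfold ee
  have : 2 * (Real.pi : ℂ) * Complex.I * (x : ℂ) = ((2 * Real.pi * x : ℝ) : ℂ) * Complex.I := by
    push_cast; ring
  rw [this, Complex.norm_exp_ofReal_mul_I]

lemma ee_conj (x : ℝ) : (starRingEnd ℂ) (ee x) = ee (-x) := by
  unfold ee
  rw [← Complex.exp_conj]
  congr 1
  simp
  left
  exact map_ofNat _ 2

lemma ee_int (n : ℤ) : ee n = 1 := by
  unfold ee
  rw [Complex.exp_eq_one_iff]
  exact ⟨n, by push_cast; ring⟩

noncomputable def nd (x : ℝ) : ℝ := |x - round x|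

lemma ee_sub_one (x : ℝ) : 4 * nd x ≤ ‖ee x - 1‖ := by
  have h1 : ee x = ee (x - round x) := by
    have : x = (x - round x) + ((round x : ℤ) : ℝ) := by ring
    conv_lhs => rw [this]
    rw [ee_add, ee_int, mul_one]
  rw [h1]
  unfold nd
  have h2 := abs_sub_round x
  set y := x - round x
  have h3 : ee y = Complex.exp (Complex.I * ((2 * Real.pi * y : ℝ) : ℂ)) := by
    unfold ee; push_cast; ring_nf
  rw [h3, Complex.norm_exp_I_mul_ofReal_sub_one, Real.norm_eq_abs, abs_mul]
  have h4 : |Real.sin (2 * Real.pi * y / 2)| = Real.sin (Real.pi * |y|) := by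
    have e : 2 * Real.pi * y / 2 = Real.pi * y := by ring
    rw [e]
    have hn : 0 ≤ Real.sin (Real.pi * |y|) := by
      apply Real.sin_nonneg_of_nonneg_of_le_pi
      · positivity
      · nlinarith [Real.pi_pos]
    rcases abs_cases y with ⟨h, _⟩ | ⟨h, _⟩
    · rw [h] at hn ⊢; rw [abs_of_nonneg hn]
    · rw [h] at hn ⊢
      rw [mul_neg, Real.sin_neg] at hn ⊢
      rw [abs_of_nonpos (by linarith)]
  rw [h4]
  have h5 := Real.mul_le_sin (x := Real.pi * |y|) (by positivity) (by nlinarith [Real.pi_pos])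
  have h6 : 2 / Real.pi * (Real.pi * |y|) = 2 * |y| := by
    field_simp
  rw [h6] at h5
  rw [abs_of_pos (by norm_num : (0:ℝ) < 2)]
  linarith

noncomputable def FF (N : ℕ) (x : ℝ) : ℝ := if nd x = 0 then (N : ℝ) else min (N : ℝ) (1 / (2 * nd x))

lemma nd_nonneg (x : ℝ) : 0 ≤ nd x := abs_nonneg _

lemma nd_le (x : ℝ) (z : ℤ) : nd x ≤ |x - z| := round_le x z

lemma nd_neg (x : ℝ) : nd (-x) = nd x := by
  apply le_antisymm
  · have := nd_le (-x) (-round x)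
    refine this.trans (le_of_eq ?_)
    unfold nd
    rw [← abs_neg]; push_cast; ring_nf
  · have := nd_le x (-round (-x))
    refine this.trans (le_of_eq ?_)
    unfold nd
    rw [← abs_neg]; push_cast; ring_nf

lemma FF_nonneg (N : ℕ) (x : ℝ) : 0 ≤ FF N x := by
  unfold FF
  have := nd_nonneg x
  split_ifs <;> positivity

lemma FF_le (N : ℕ) (x : ℝ) : FF N x ≤ N := by
  unfold FF
  split_ifs
  · exact le_rfl
  · exact min_le_left _ _

lemma FF_neg (N : ℕ) (x : ℝ) : FF N (-x) = FF N x := by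
  unfold FF; rw [nd_neg]

lemma FF_le_of (N : ℕ) (x s : ℝ) (hs : 0 < s) (h : s ≤ nd x) : FF N x ≤ 1 / (2 * s) := by
  unfold FF
  rw [if_neg (by linarith)]
  refine (min_le_right _ _).trans ?_
  gcongr

lemma tele (u : ℤ → ℂ) (a : ℤ) (t : ℕ) :
    ∑ n ∈ Finset.Icc a (a + t), (u (n + 1) - u n) = u (a + t + 1) - u a := by
  induction t with
  | zero => simp
  | succ t ih =>
    have : Finset.Icc a (a + ((t + 1 : ℕ) : ℤ)) = insert (a + t + 1) (Finset.Icc a (a + t)) := by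
      ext x; simp only [Finset.mem_Icc, Finset.mem_insert]; push_cast; omega
    rw [this, Finset.sum_insert (by simp), ih]
    push_cast
    ring_nf

lemma norm_sum_le_N (u : ℤ → ℂ) (hu : ∀ n, ‖u n‖ = 1) (a b : ℤ) (N : ℕ) (h : b + 1 - a ≤ N) :
    ‖∑ n ∈ Finset.Icc a b, u n‖ ≤ N := by
  refine (norm_sum_le _ _).trans ?_
  simp only [hu, Finset.sum_const, nsmul_eq_mul, mul_one, Int.card_Icc]
  exact_mod_cast (by omega : (b + 1 - a).toNat ≤ N)

lemma linear_bound (N : ℕ) (a b : ℤ) (hN : b + 1 - a ≤ N) (c γ : ℝ) :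
    ‖∑ n ∈ Finset.Icc a b, ee (c * n + γ)‖ ≤ FF N c := by
  have h1 := norm_sum_le_N (fun n : ℤ => ee (c * n + γ)) (fun n => ee_norm _) a b N hN
  unfold FF
  split_ifs with h0
  · exact h1
  · refine le_min h1 ?_
    have hp : 0 < nd c := lt_of_le_of_ne (nd_nonneg c) (Ne.symm h0)
    rw [le_div_iff₀ (by positivity)]
    rcases lt_or_ge b a with hab | hab
    · rw [Finset.Icc_eq_empty (by omega)]; simp
    obtain ⟨t, rfl⟩ := Int.le.dest hab
    have h2 := tele (fun n : ℤ => ee (c * n + γ)) a t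
    have h3 : ∀ n : ℤ, ee (c * ((n + 1 : ℤ) : ℝ) + γ) - ee (c * n + γ) = (ee c - 1) * ee (c * n + γ) := by
      intro n
      have : c * ((n + 1 : ℤ) : ℝ) + γ = c + (c * n + γ) := by push_cast; ring
      rw [this, ee_add]; ring
    simp only [h3, ← Finset.mul_sum] at h2
    have h4 : ‖ee c - 1‖ * ‖∑ n ∈ Finset.Icc a (a + t), ee (c * n + γ)‖ ≤ 2 := by
      rw [← norm_mul, h2]
      refine (norm_sub_le _ _).trans ?_
      rw [ee_norm, ee_norm]; norm_num
    have h5 := ee_sub_one c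
    have := norm_nonneg (∑ n ∈ Finset.Icc a (a + (t:ℤ)), ee (c * n + γ))
    nlinarith

lemma vdc (u : ℤ → ℂ) (a b : ℤ) (N : ℕ) (h : b + 1 - a ≤ N) :
    ‖∑ n ∈ Finset.Icc a b, u n‖ ^ 2 ≤ ∑ h ∈ Finset.Ioo (-(N : ℤ)) N,
      ‖∑ n ∈ Finset.Icc (max a (a - h)) (min b (b - h)), u (n + h) * (starRingEnd ℂ) (u n)‖ := by
  have h1 : ((‖∑ n ∈ Finset.Icc a b, u n‖ ^ 2 : ℝ) : ℂ) = ∑ h ∈ Finset.Ioo (-(N : ℤ)) N,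
      ∑ n ∈ Finset.Icc (max a (a - h)) (min b (b - h)), u (n + h) * (starRingEnd ℂ) (u n) := by
    have e : ∀ h : ℤ, Finset.Icc (max a (a - h)) (min b (b - h)) =
        (Finset.Icc a b).filter (fun n => n + h ∈ Finset.Icc a b) := by
      intro h; ext n; simp only [Finset.mem_Icc, Finset.mem_filter]; omega
    simp only [e, Finset.sum_filter]
    rw [Finset.sum_comm]
    have : ∀ n ∈ Finset.Icc a b, (∑ h ∈ Finset.Ioo (-(N : ℤ)) N,
        if n + h ∈ Finset.Icc a b then u (n + h) * (starRingEnd ℂ) (u n) else 0)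
        = ∑ m ∈ Finset.Icc a b, u m * (starRingEnd ℂ) (u n) := by
      intro n hn
      rw [← Finset.sum_filter]
      refine Finset.sum_nbij' (fun h => n + h) (fun m => m - n) ?_ ?_ ?_ ?_ ?_
      · intro h hh; simp only [Finset.mem_filter] at hh; exact hh.2
      · intro m hm
        simp only [Finset.mem_filter, Finset.mem_Ioo, Finset.mem_Icc] at *
        omega
      · intros; ring
      · intros; ring
      · intros; rfl
    rw [Finset.sum_congr rfl this]
    simp only [← Finset.sum_mul, ← Finset.mul_sum, ← map_sum]
    rw [Complex.mul_conj, Complex.normSq_eq_norm_sq]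
  have h2 : ‖((‖∑ n ∈ Finset.Icc a b, u n‖ ^ 2 : ℝ) : ℂ)‖ = ‖∑ n ∈ Finset.Icc a b, u n‖ ^ 2 := by
    rw [Complex.norm_real, Real.norm_of_nonneg (by positivity)]
  rw [← h2, h1]
  exact _root_.norm_sum_le _ _

noncomputable def GG (N : ℕ) : ℕ → ℝ → ℝ
  | 0, β => FF N β
  | j + 1, β => ∑ h ∈ Finset.Ioo (-(N : ℤ)) N, GG N j (((j : ℝ) + 2) * h * β)

open Polynomial in
lemma diff_coeff (P : ℝ[X]) (j : ℕ) (hP : P.natDegree ≤ j + 1) (h : ℝ) :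
    (taylor h P - P).natDegree ≤ j ∧
      (taylor h P - P).coeff j = ((j : ℝ) + 1) * h * P.coeff (j + 1) := by
  have hd : ∀ n, j + 1 < n → P.coeff n = 0 := fun n hn => coeff_eq_zero_of_natDegree_lt (by omega)
  constructor
  · rw [natDegree_le_iff_coeff_eq_zero]
    intro n hn
    rw [coeff_sub, taylor_coeff]
    have : hasseDeriv n P = C (P.coeff n) := by
      ext i
      rw [hasseDeriv_coeff, coeff_C]
      split_ifs with hi
      · subst hi; simp
      · rw [hd _ (by omega)]; simp
    rw [this]; simp
  · rw [coeff_sub, taylor_coeff]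
    have : hasseDeriv j P = C (P.coeff j) + C (((j : ℝ) + 1) * P.coeff (j + 1)) * X := by
      ext i
      rw [hasseDeriv_coeff, coeff_add, coeff_C, coeff_C_mul, coeff_X]
      rcases i with _ | _ | i
      · simp
      · simp [add_comm 1 j]
      · rw [hd _ (by omega)]; simp
    rw [this]; simp; ring

lemma pow_sum_le {ι : Type*} (s : Finset ι) (f : ι → ℝ) (hf : ∀ i ∈ s, 0 ≤ f i) (T : ℝ) (hT : 0 ≤ T)
    (hs : (s.card : ℝ) ≤ T) (n : ℕ) (hn : 0 < n) :
    T * (∑ i ∈ s, f i) ^ n ≤ T ^ n * ∑ i ∈ s, f i ^ n := by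
  obtain ⟨m, rfl⟩ : ∃ m, n = m + 1 := ⟨n - 1, by omega⟩
  rcases s.eq_empty_or_nonempty with rfl | hne
  · simp
  have h1 := pow_sum_div_card_le_sum_pow (s := s) (f := f) (n := m) hf
  have hc : (0:ℝ) < s.card := by exact_mod_cast hne.card_pos
  rw [div_le_iff₀ (by positivity)] at h1
  have h2 : 0 ≤ ∑ i ∈ s, f i ^ (m+1) := Finset.sum_nonneg fun i hi => pow_nonneg (hf i hi) _
  calc T * (∑ i ∈ s, f i) ^ (m+1) ≤ T * ((∑ i ∈ s, f i ^ (m+1)) * T ^ m) := by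
        apply mul_le_mul_of_nonneg_left _ hT
        refine h1.trans ?_
        gcongr
    _ = _ := by ring

open Polynomial in
lemma weyl_diff (N : ℕ) (j : ℕ) : ∀ (P : ℝ[X]) (_ : P.natDegree ≤ j + 1) (a b : ℤ)
    (_ : b + 1 - a ≤ N),
    (2 * (N:ℝ)) ^ (j + 1) * ‖∑ n ∈ Finset.Icc a b, ee (P.eval (n : ℝ))‖ ^ (2 ^ j) ≤
      (2 * (N:ℝ)) ^ (2 ^ j) * GG N j (P.coeff (j + 1)) := by
  induction j with
  | zero =>
    intro P hP a b hab
    have h1 : ∀ n : ℤ, P.eval (n:ℝ) = P.coeff 1 * n + P.coeff 0 := by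
      intro n
      rw [eval_eq_sum_range' (n := 2) (by omega)]
      simp [Finset.sum_range_succ]; ring
    simp only [h1]
    have := linear_bound N a b hab (P.coeff 1) (P.coeff 0)
    simp only [GG, zero_add, pow_one, pow_zero]
    gcongr
  | succ j ih =>
    intro P hP a b hab
    have hv := vdc (fun n : ℤ => ee (P.eval (n:ℝ))) a b N hab
    set S := ‖∑ n ∈ Finset.Icc a b, ee (P.eval (n : ℝ))‖
    have hS : 0 ≤ S := norm_nonneg _
    have h1 : ∀ (h n : ℤ), ee (P.eval ((n + h : ℤ) : ℝ)) * (starRingEnd ℂ) (ee (P.eval (n:ℝ))) =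
        ee ((taylor (h:ℝ) P - P).eval (n:ℝ)) := by
      intro h n
      rw [ee_conj, ← ee_add, eval_sub, taylor_eval]
      push_cast
      rw [sub_eq_add_neg]
    simp only [h1] at hv
    set Sh : ℤ → ℝ := fun h => ‖∑ n ∈ Finset.Icc (max a (a - h)) (min b (b - h)),
      ee ((taylor (h:ℝ) P - P).eval (n:ℝ))‖ with hSh
    have hv' : S ^ 2 ≤ ∑ h ∈ Finset.Ioo (-(N : ℤ)) N, Sh h := hv
    have hcard : ((Finset.Ioo (-(N : ℤ)) N).card : ℝ) ≤ 2 * N := by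
      rw [Int.card_Ioo]
      exact_mod_cast (by omega : ((N:ℤ) - (-(N:ℤ)) - 1).toNat ≤ 2 * N)
    have hp := pow_sum_le (Finset.Ioo (-(N : ℤ)) N) Sh (fun i _ => norm_nonneg _) (2 * N)
      (by positivity) hcard (2 ^ j) (by positivity)
    have hih : ∀ h ∈ Finset.Ioo (-(N : ℤ)) N, (2 * (N:ℝ)) ^ (j + 1) * Sh h ^ (2 ^ j) ≤
        (2 * (N:ℝ)) ^ (2 ^ j) * GG N j (((j:ℝ) + 2) * h * P.coeff (j + 1 + 1)) := by
      intro h _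
      have hd := diff_coeff P (j + 1) hP (h:ℝ)
      have := ih _ hd.1 (max a (a - h)) (min b (b - h)) (by omega)
      rw [hd.2] at this
      have e : (((j + 1 : ℕ) : ℝ) + 1) = (j:ℝ) + 2 := by push_cast; ring
      rw [e] at this
      exact this
    have hsum := Finset.sum_le_sum hih
    rw [← Finset.mul_sum, ← Finset.mul_sum] at hsum
    have hT : (0:ℝ) ≤ 2 * N := by positivity
    calc (2 * (N:ℝ)) ^ (j + 1 + 1) * S ^ (2 ^ (j + 1))
        = (2 * (N:ℝ)) ^ (j + 1) * (2 * N * (S ^ 2) ^ (2 ^ j)) := by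
          rw [← pow_mul]; ring
      _ ≤ (2 * (N:ℝ)) ^ (j + 1) * (2 * N * (∑ h ∈ Finset.Ioo (-(N : ℤ)) N, Sh h) ^ (2 ^ j)) := by
          gcongr
      _ ≤ (2 * (N:ℝ)) ^ (j + 1) * ((2 * N) ^ (2 ^ j) * ∑ h ∈ Finset.Ioo (-(N : ℤ)) N, Sh h ^ (2 ^ j)) := by
          gcongr
      _ = (2 * N) ^ (2 ^ j) * ((2 * (N:ℝ)) ^ (j + 1) * ∑ h ∈ Finset.Ioo (-(N : ℤ)) N, Sh h ^ (2 ^ j)) := by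
          ring
      _ ≤ (2 * N) ^ (2 ^ j) * ((2 * (N:ℝ)) ^ (2 ^ j) * ∑ h ∈ Finset.Ioo (-(N : ℤ)) N,
            GG N j (((j:ℝ) + 2) * h * P.coeff (j + 1 + 1))) := by
          gcongr
      _ = _ := by
          simp only [GG]; rw [pow_succ 2 j]; ring

lemma divisor_bound (δ : ℝ) (hδ : 0 < δ) : ∃ A : ℝ, 1 ≤ A ∧ ∀ n : ℕ, n ≠ 0 →
    ((n.divisors.card : ℕ) : ℝ) ≤ A * (n : ℝ) ^ δ := by
  set B : ℝ := 1 + 1 / (δ * Real.log 2) with hB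
  have hl : 0 < Real.log 2 := Real.log_pos (by norm_num)
  have hB1 : 1 ≤ B := by rw [hB]; have : 0 < 1 / (δ * Real.log 2) := by positivity
                         linarith
  set R : ℕ := ⌈(2:ℝ) ^ (1 / δ)⌉₊ with hR
  refine ⟨B ^ R, one_le_pow₀ hB1, ?_⟩
  intro n hn
  have h1 : ∀ p ∈ n.primeFactors, ((n.factorization p + 1 : ℕ) : ℝ) ≤
      (if p < R then B else 1) * ((p : ℝ) ^ (n.factorization p)) ^ δ := by
    intro p hp
    have hp2 : (2:ℝ) ≤ p := by exact_mod_cast (Nat.prime_of_mem_primeFactors hp).two_le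
    set v := n.factorization p
    have e : ((p : ℝ) ^ v) ^ δ = ((p:ℝ) ^ δ) ^ v := by
      rw [← Real.rpow_natCast, ← Real.rpow_mul (by positivity), mul_comm, Real.rpow_mul (by positivity),
        Real.rpow_natCast]
    rw [e]
    split_ifs with hpR
    · have h2 : (2:ℝ) ^ δ ≤ (p:ℝ) ^ δ := by gcongr
      have h3 : 1 + δ * Real.log 2 ≤ (2:ℝ) ^ δ := by
        rw [Real.rpow_def_of_pos (by norm_num)]
        have := Real.add_one_le_exp (Real.log 2 * δ)
        linarith
      have h4 : 1 + (v:ℝ) * (δ * Real.log 2) ≤ (1 + δ * Real.log 2) ^ v :=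
        one_add_mul_le_pow (by nlinarith [mul_pos hδ hl]) v
      have h5 : (1 + δ * Real.log 2) ^ v ≤ ((p:ℝ) ^ δ) ^ v :=
        pow_le_pow_left₀ (by positivity) (h3.trans h2) v
      have h6 : (v:ℝ) + 1 ≤ B * (1 + (v:ℝ) * (δ * Real.log 2)) := by
        have : B * (1 + (v:ℝ) * (δ * Real.log 2)) = 1 + v * (δ * Real.log 2) + 1 / (δ * Real.log 2) + v := by
          rw [hB]; field_simp; ring
        rw [this]
        have : 0 ≤ (v:ℝ) * (δ * Real.log 2) := by positivity
        have : 0 ≤ 1 / (δ * Real.log 2) := by positivity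
        linarith
      push_cast
      refine h6.trans ?_
      apply mul_le_mul_of_nonneg_left (h4.trans h5) (by linarith)
    · have h2 : (2:ℝ) ≤ (p:ℝ) ^ δ := by
        have : (2:ℝ) ^ (1/δ) ≤ p := (Nat.le_ceil _).trans (by exact_mod_cast not_lt.mp hpR)
        calc (2:ℝ) = ((2:ℝ) ^ (1/δ)) ^ δ := by
              rw [← Real.rpow_mul (by norm_num)]; field_simp; simp
          _ ≤ _ := by gcongr
      rw [one_mul]
      calc ((v + 1 : ℕ) : ℝ) ≤ ((2 ^ v : ℕ) : ℝ) := by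
            exact_mod_cast Nat.lt_two_pow_self
        _ = (2:ℝ) ^ v := by push_cast; rfl
        _ ≤ _ := pow_le_pow_left₀ (by norm_num) h2 v
  rw [Nat.card_divisors hn]
  push_cast at h1 ⊢
  refine (Finset.prod_le_prod (fun _ _ => by positivity) h1).trans ?_
  rw [Finset.prod_mul_distrib]
  have h2 : ∏ p ∈ n.primeFactors, ((p : ℝ) ^ (n.factorization p)) ^ δ = (n:ℝ) ^ δ := by
    rw [Real.finsetProd_rpow _ _ (fun _ _ => by positivity)]
    congr 1
    have := Nat.prod_factorization_pow_eq_self hn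
    conv_rhs => rw [← this]
    rw [Finsupp.prod, Nat.support_factorization]
    push_cast; rfl
  rw [h2]
  apply mul_le_mul_of_nonneg_right _ (by positivity)
  rw [← Finset.prod_filter, Finset.prod_const]
  apply pow_le_pow_right₀ hB1
  calc _ ≤ (Finset.range R).card := by
        apply Finset.card_le_card
        intro p hp
        simp only [Finset.mem_filter] at hp
        exact Finset.mem_range.mpr hp.2
    _ = R := by simp

noncomputable def psi (N q : ℕ) (s : ℕ) : ℝ := if s ≤ 2 then (N:ℝ) else (q:ℝ) / (2 * ((s:ℝ) - 2))

lemma psi_nonneg (N q s : ℕ) : 0 ≤ psi N q s := by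
  unfold psi
  split_ifs with h
  · positivity
  · have : (3:ℝ) ≤ s := by exact_mod_cast (by omega : 3 ≤ s)
    apply div_nonneg (by positivity); linarith

lemma psi_sum (N q : ℕ) : ∑ s ∈ Finset.range (3 + q), psi N q s ≤ 3 * N + q / 2 * (1 + Real.log q) := by
  rw [Finset.sum_range_add]
  have h1 : ∑ s ∈ Finset.range 3, psi N q s = 3 * N := by
    simp [Finset.sum_range_succ, psi]; ring
  have h2 : ∑ s ∈ Finset.range q, psi N q (3 + s) = q / 2 * (harmonic q : ℚ) := by
    rw [harmonic]
    push_cast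
    rw [Finset.mul_sum]
    apply Finset.sum_congr rfl
    intro s _
    unfold psi
    rw [if_neg (by omega)]
    push_cast
    have : (3 + (s:ℝ) - 2) = s + 1 := by ring
    rw [this]
    field_simp
  rw [h1, h2]
  have := harmonic_le_one_add_log q
  gcongr

lemma block (N q : ℕ) (hq : 0 < q) (a : ℤ) (ha : Int.gcd a q = 1) (β : ℝ)
    (hβ : |β - (a:ℝ) / q| ≤ ((q:ℝ) ^ 2)⁻¹) (γ : ℝ) :
    ∑ r ∈ Finset.range q, FF N (γ + r * β) ≤ 6 * N + q * (1 + Real.log q) := by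
  have hq0 : (0:ℝ) < q := by exact_mod_cast hq
  have hqz : (q:ℤ) ≠ 0 := by omega
  set c : ℕ → ℕ := fun r => ((a * r + ⌊(q:ℝ) * γ⌋) % (q:ℤ)).toNat with hc
  have hcz : ∀ r, ((c r : ℕ) : ℤ) = (a * r + ⌊(q:ℝ) * γ⌋) % (q:ℤ) := by
    intro r; exact Int.toNat_of_nonneg (Int.emod_nonneg _ hqz)
  have hclt : ∀ r, c r < q := by
    intro r
    have := Int.emod_lt_of_pos (a * r + ⌊(q:ℝ) * γ⌋) (by omega : (0:ℤ) < q)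
    rw [← hcz] at this
    exact_mod_cast this
  have hinj : Set.InjOn c (Finset.range q : Set ℕ) := by
    intro r hr s hs h
    simp only [Finset.coe_range, Set.mem_Iio] at hr hs
    have h1 : (a * r + ⌊(q:ℝ) * γ⌋) % (q:ℤ) = (a * s + ⌊(q:ℝ) * γ⌋) % (q:ℤ) := by
      rw [← hcz, ← hcz, h]
    have h2 : (q:ℤ) ∣ (a * s + ⌊(q:ℝ) * γ⌋) - (a * r + ⌊(q:ℝ) * γ⌋) := Int.ModEq.dvd h1
    have h3 : (a * s + ⌊(q:ℝ) * γ⌋) - (a * r + ⌊(q:ℝ) * γ⌋) = a * ((s:ℤ) - r) := by ring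
    rw [h3] at h2
    have hco : IsCoprime (q:ℤ) a := (Int.isCoprime_iff_gcd_eq_one.mpr ha).symm
    have h4 := hco.dvd_of_dvd_mul_left h2
    have h5 := Int.eq_zero_of_abs_lt_dvd h4 (by rw [abs_lt]; omega)
    omega
  have key : ∀ r ∈ Finset.range q, FF N (γ + r * β) ≤ psi N q (c r) + psi N q (q - 1 - c r + 1) := by
    intro r hr
    have hrq : r < q := Finset.mem_range.mp hr
    have hm : FF N (γ + r * β) ≤ psi N q (min (c r) (q - c r)) := by
      unfold psi
      split_ifs with hs
      · exact FF_le _ _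
      · set s := min (c r) (q - c r) with hsdef
        have hs3 : (3:ℝ) ≤ s := by exact_mod_cast (by omega : 3 ≤ s)
        have hnd : ((s:ℝ) - 2) / q ≤ nd (γ + r * β) := by
          unfold nd
          set z := round (γ + r * β)
          rw [div_le_iff₀ hq0]
          have e0 : |γ + r * β - z| * q = |(q:ℝ) * (γ + r * β - z)| := by
            rw [abs_mul, abs_of_pos hq0, mul_comm]
          rw [e0]
          set t : ℤ := (a * r + ⌊(q:ℝ) * γ⌋) / (q:ℤ)
          have ht : a * r + ⌊(q:ℝ) * γ⌋ = c r + q * t := by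
            rw [hcz]; exact (Int.emod_add_mul_ediv _ _).symm
          have ht' : (a:ℝ) * r + ⌊(q:ℝ) * γ⌋ = c r + q * t := by exact_mod_cast ht
          have hfr := Int.self_sub_floor ((q:ℝ) * γ)
          have hf0 := Int.fract_nonneg ((q:ℝ) * γ)
          have hf1 := Int.fract_lt_one ((q:ℝ) * γ)
          set η := (r:ℝ) * q * (β - a / q) with hη
          have hηb : |η| ≤ 1 := by
            rw [hη, abs_mul, abs_of_nonneg (by positivity)]
            have : (r:ℝ) ≤ q := by exact_mod_cast hrq.le
            calc (r:ℝ) * q * |β - a / q| ≤ q * q * ((q:ℝ) ^ 2)⁻¹ := by gcongr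
              _ = 1 := by field_simp
          have e1 : (q:ℝ) * (γ + r * β - z) = ((c r + q * (t - z) : ℤ) : ℝ) +
              (Int.fract ((q:ℝ) * γ) + η) := by
            have : η = r * q * β - a * r := by rw [hη]; field_simp
            push_cast
            rw [this, ← hfr]
            linear_combination ht'
          rw [e1]
          have h5 : ((s:ℤ):ℝ) ≤ |((c r + q * (t - z) : ℤ) : ℝ)| := by
            rw [← Int.cast_abs]
            norm_cast
            have hs1 : (s:ℤ) ≤ c r := by exact_mod_cast (min_le_left _ _)
            have hs2 : (s:ℤ) + c r ≤ q := by
              have := hclt r; omega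
            rcases le_or_gt 0 (t - z) with hw | hw
            · rw [le_abs]; left; nlinarith
            · rw [le_abs]; right; nlinarith
          have h6 : |Int.fract ((q:ℝ) * γ) + η| ≤ 2 := by
            rw [abs_le] at hηb ⊢
            constructor <;> linarith
          have h7 := abs_sub_abs_le_abs_sub ((c r + q * (t - z) : ℤ) : ℝ) (-(Int.fract ((q:ℝ) * γ) + η))
          rw [abs_neg, sub_neg_eq_add] at h7
          push_cast at h5 h7 ⊢
          linarith
        have := FF_le_of N _ _ (by apply div_pos _ hq0; linarith) hnd
        refine this.trans (le_of_eq ?_)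
        have : (s:ℝ) - 2 ≠ 0 := by linarith
        field_simp
    have e : q - 1 - c r + 1 = q - c r := by have := hclt r; omega
    rw [e]
    rcases min_choice (c r) (q - c r) with h | h <;> rw [h] at hm
    · linarith [psi_nonneg N q (q - c r)]
    · linarith [psi_nonneg N q (c r)]
  refine (Finset.sum_le_sum key).trans ?_
  have himg : ∑ r ∈ Finset.range q, (psi N q (c r) + psi N q (q - 1 - c r + 1)) ≤
      ∑ x ∈ Finset.range q, (psi N q x + psi N q (q - 1 - x + 1)) := by
    rw [← Finset.sum_image (f := fun x => psi N q x + psi N q (q - 1 - x + 1)) hinj]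
    apply Finset.sum_le_sum_of_subset_of_nonneg
    · intro x hx
      obtain ⟨r, _, rfl⟩ := Finset.mem_image.mp hx
      exact Finset.mem_range.mpr (hclt r)
    · intros; exact add_nonneg (psi_nonneg _ _ _) (psi_nonneg _ _ _)
  refine himg.trans ?_
  rw [Finset.sum_add_distrib, Finset.sum_range_reflect (fun x => psi N q (x + 1))]
  have hA : ∑ x ∈ Finset.range q, psi N q x ≤ ∑ s ∈ Finset.range (3 + q), psi N q s := by
    apply Finset.sum_le_sum_of_subset_of_nonneg
    · apply Finset.range_mono; omega
    · intros; exact psi_nonneg _ _ _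
  have hB : ∑ x ∈ Finset.range q, psi N q (x + 1) ≤ ∑ s ∈ Finset.range (3 + q), psi N q s := by
    have : ∑ x ∈ Finset.range q, psi N q (x + 1) ≤ ∑ x ∈ Finset.range (q + 1), psi N q x := by
      rw [Finset.sum_range_succ']
      linarith [psi_nonneg N q 0]
    refine this.trans ?_
    apply Finset.sum_le_sum_of_subset_of_nonneg
    · apply Finset.range_mono; omega
    · intros; exact psi_nonneg _ _ _
  have := psi_sum N q
  linarith

lemma blocks (N q : ℕ) (hq : 0 < q) (a : ℤ) (ha : Int.gcd a q = 1) (β : ℝ)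
    (hβ : |β - (a:ℝ) / q| ≤ ((q:ℝ) ^ 2)⁻¹) (M : ℕ) :
    ∑ m ∈ Finset.Icc 1 M, FF N (m * β) ≤ ((M:ℝ) / q + 1) * (6 * N + q * (1 + Real.log q)) := by
  have hq0 : (0:ℝ) < q := by exact_mod_cast hq
  have hlog : 0 ≤ Real.log q := Real.log_natCast_nonneg q
  have h1 : ∀ B : ℕ, ∑ m ∈ Finset.range (q * B), FF N (((m + 1 : ℕ):ℝ) * β) ≤
      B * (6 * N + q * (1 + Real.log q)) := by
    intro B
    induction B with
    | zero => simp
    | succ B ih =>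
      rw [Nat.mul_succ, Finset.sum_range_add]
      have := block N q hq a ha β hβ ((q * B + 1 : ℕ) * β)
      have e : ∀ r : ℕ, ((q * B + 1 : ℕ) : ℝ) * β + r * β = ((q * B + r + 1 : ℕ) : ℝ) * β := by
        intro r; push_cast; ring
      simp only [e] at this
      push_cast at *
      linarith
  have h2 : ∑ m ∈ Finset.Icc 1 M, FF N (m * β) ≤
      ∑ m ∈ Finset.range (q * (M / q + 1)), FF N (((m + 1 : ℕ):ℝ) * β) := by
    have e : ∑ m ∈ Finset.Icc 1 M, FF N (m * β) = ∑ m ∈ Finset.range M, FF N (((m + 1 : ℕ):ℝ) * β) := by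
      rw [Finset.range_eq_Ico, Finset.sum_Ico_add' (fun m : ℕ => FF N ((m:ℝ) * β)) 0 M 1]
      rfl
    rw [e]
    apply Finset.sum_le_sum_of_subset_of_nonneg
    · apply Finset.range_mono
      exact (Nat.lt_mul_div_succ M hq).le
    · intros; exact FF_nonneg _ _
  refine h2.trans ((h1 _).trans ?_)
  apply mul_le_mul_of_nonneg_right _ (by positivity)
  push_cast
  have := Nat.cast_div_le (α := ℝ) (m := M) (n := q)
  linarith

lemma GG_nonneg (N j : ℕ) : ∀ β, 0 ≤ GG N j β := by
  induction j with
  | zero => intro β; exact FF_nonneg _ _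
  | succ j ih => intro β; exact Finset.sum_nonneg fun h _ => ih _

lemma GG_neg (N j : ℕ) : ∀ β, GG N j (-β) = GG N j β := by
  induction j with
  | zero => intro β; exact FF_neg _ _
  | succ j ih =>
    intro β
    simp only [GG]
    apply Finset.sum_congr rfl
    intro h _
    rw [mul_neg, ih]

lemma GG_le (N j : ℕ) : ∀ β, GG N j β ≤ (2 * (N:ℝ)) ^ j * N := by
  induction j with
  | zero => intro β; simpa [GG] using FF_le N β
  | succ j ih =>
    intro β
    simp only [GG]
    refine (Finset.sum_le_sum fun h _ => ih _).trans ?_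
    rw [Finset.sum_const, nsmul_eq_mul]
    have hcard : ((Finset.Ioo (-(N : ℤ)) N).card : ℝ) ≤ 2 * N := by
      rw [Int.card_Ioo]
      exact_mod_cast (by omega : ((N:ℤ) - (-(N:ℤ)) - 1).toNat ≤ 2 * N)
    calc _ ≤ (2 * (N:ℝ)) * ((2 * (N:ℝ)) ^ j * N) := by gcongr
      _ = _ := by ring

lemma sum_sym (N : ℕ) (φ : ℤ → ℝ) (h0 : ∀ h, 0 ≤ φ h) (he : ∀ h, φ (-h) = φ h) :
    ∑ h ∈ Finset.Ioo (-(N : ℤ)) N, φ h ≤ φ 0 + 2 * ∑ h ∈ Finset.Icc 1 N, φ ((h : ℕ) : ℤ) := by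
  set A := (Finset.Icc 1 N).image (fun h : ℕ => (h : ℤ))
  set B := (Finset.Icc 1 N).image (fun h : ℕ => -(h : ℤ))
  have hA : ∑ h ∈ A, φ h = ∑ h ∈ Finset.Icc 1 N, φ ((h : ℕ) : ℤ) :=
    Finset.sum_image (fun x _ y _ h => by simpa using h)
  have hB : ∑ h ∈ B, φ h = ∑ h ∈ Finset.Icc 1 N, φ ((h : ℕ) : ℤ) := by
    rw [Finset.sum_image (fun x _ y _ h => by simpa using h)]
    simp [he]
  have hsub : Finset.Ioo (-(N : ℤ)) N ⊆ ({0} ∪ A) ∪ B := by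
    intro x hx
    simp only [A, B, Finset.mem_union, Finset.mem_singleton, Finset.mem_image, Finset.mem_Icc,
      Finset.mem_Ioo] at *
    rcases lt_trichotomy x 0 with h | h | h
    · right; exact ⟨x.natAbs, by omega, by omega⟩
    · left; left; exact h
    · left; right; exact ⟨x.natAbs, by omega, by omega⟩
  have u : ∀ s t : Finset ℤ, ∑ h ∈ s ∪ t, φ h ≤ ∑ h ∈ s, φ h + ∑ h ∈ t, φ h := by
    intro s t
    rw [← Finset.sum_union_inter]
    have : 0 ≤ ∑ h ∈ s ∩ t, φ h := Finset.sum_nonneg fun h _ => h0 h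
    linarith
  have h1 := Finset.sum_le_sum_of_subset_of_nonneg hsub (fun h _ _ => h0 h)
  have h2 := u ({0} ∪ A) B
  have h3 := u {0} A
  rw [Finset.sum_singleton] at h3
  linarith

lemma fiber (N M l M' : ℕ) (hl : 0 < l) (hM' : l * N * M ≤ M') (τ : ℝ)
    (hτ : ∀ m : ℕ, m ≠ 0 → m ≤ M' → ((m.divisors.card : ℕ):ℝ) ≤ τ) (β : ℝ) :
    ∑ h ∈ Finset.Icc 1 N, ∑ m ∈ Finset.Icc 1 M, FF N ((m:ℝ) * ((l:ℝ) * ((h:ℕ):ℝ) * β)) ≤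
      τ * ∑ m ∈ Finset.Icc 1 M', FF N (m * β) := by
  rw [← Finset.sum_product']
  set g : ℕ × ℕ → ℕ := fun p => l * p.1 * p.2
  have hmaps : ∀ p ∈ Finset.Icc 1 N ×ˢ Finset.Icc 1 M, g p ∈ Finset.Icc 1 M' := by
    rintro ⟨h, m⟩ hp
    simp only [Finset.mem_product, Finset.mem_Icc, g] at *
    obtain ⟨⟨h1, h2⟩, h3, h4⟩ := hp
    constructor
    · exact Nat.succ_le_of_lt (by positivity)
    · exact le_trans (by gcongr) hM'
  rw [← Finset.sum_fiberwise_of_maps_to hmaps, Finset.mul_sum]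
  apply Finset.sum_le_sum
  intro m' hm'
  rw [Finset.mem_Icc] at hm'
  have e : ∀ p ∈ (Finset.Icc 1 N ×ˢ Finset.Icc 1 M).filter (fun p => g p = m'),
      FF N ((p.2:ℝ) * ((l:ℝ) * ((p.1:ℕ):ℝ) * β)) = FF N (m' * β) := by
    intro p hp
    rw [Finset.mem_filter] at hp
    rw [← hp.2]
    simp only [g]
    push_cast
    ring_nf
  rw [Finset.sum_congr rfl e, Finset.sum_const, nsmul_eq_mul]
  apply mul_le_mul_of_nonneg_right _ (FF_nonneg _ _)
  refine le_trans ?_ (hτ m' (by omega) hm'.2)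
  norm_cast
  apply Finset.card_le_card_of_injOn Prod.fst
  · rintro ⟨h, m⟩ hp
    simp only [Finset.coe_filter, Set.mem_ofPred_eq, g] at hp
    simp only [Finset.mem_coe, Nat.mem_divisors]
    exact ⟨⟨l * m, by rw [← hp.2]; ring⟩, by omega⟩
  · rintro ⟨h, m⟩ hp ⟨h', m'⟩ hp' heq
    simp only [Finset.coe_filter, Set.mem_ofPred_eq, g, Finset.mem_product, Finset.mem_Icc] at hp hp' heq
    subst heq
    have := hp.2.trans hp'.2.symm
    have hpos : 0 < l * h := by have := hp.1.1.1; positivity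
    rw [Nat.mul_left_cancel hpos this]

lemma GG_main (N : ℕ) (τ : ℝ) (hτ0 : 0 ≤ τ) (K : ℕ)
    (hτ : ∀ m : ℕ, m ≠ 0 → m ≤ K → ((m.divisors.card : ℕ):ℝ) ≤ τ) (hN : 0 < N) (j : ℕ) :
    ∀ (_ : (j + 1).factorial * N ^ j ≤ K) (β : ℝ), GG N j β ≤ ((j:ℝ) + 1) * (2 * N) ^ j +
      (2 * τ) ^ j * ∑ m ∈ Finset.Icc 1 ((j + 1).factorial * N ^ j), FF N (m * β) := by
  induction j with
  | zero => intro _ β; simp [GG]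
  | succ j ih =>
    intro hK β
    set M := (j + 1).factorial * N ^ j
    have hM : (j + 1 + 1).factorial * N ^ (j + 1) = (j + 2) * N * M := by
      rw [Nat.factorial_succ (j + 1), pow_succ]; ring
    have hMK : M ≤ K := by
      rw [hM] at hK
      have : 1 ≤ (j + 2) * N := Nat.succ_le_of_lt (by positivity)
      nlinarith
    have h1 := sum_sym N (fun h : ℤ => GG N j (((j : ℝ) + 2) * h * β)) (fun h => GG_nonneg _ _ _)
      (fun h => by
        have : ((j : ℝ) + 2) * ((-h : ℤ) : ℝ) * β = -(((j : ℝ) + 2) * h * β) := by push_cast; ring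
        simp only [this, GG_neg])
    have h2 := GG_le N j (((j : ℝ) + 2) * ((0:ℤ):ℝ) * β)
    have h3 := Finset.sum_le_sum (s := Finset.Icc 1 N)
      (fun (h : ℕ) _ => ih hMK (((j : ℝ) + 2) * h * β))
    rw [Finset.sum_add_distrib, Finset.sum_const, nsmul_eq_mul, ← Finset.mul_sum, Nat.card_Icc,
      Nat.add_sub_cancel] at h3
    have h4 := fiber N M (j + 2) ((j + 2) * N * M) (by omega) le_rfl τ
      (fun m hm hm' => hτ m hm (hm'.trans (by rw [← hM]; exact hK))) β
    push_cast at h4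
    rw [hM]
    simp only [GG]
    simp only [Int.cast_natCast] at h1
    have h5 := mul_le_mul_of_nonneg_left h4 (by positivity : 0 ≤ (2 * τ) ^ j)
    have hNN : (0:ℝ) ≤ (2 * N) ^ j * N := by positivity
    calc _ ≤ _ := h1
      _ ≤ (2 * (N:ℝ)) ^ j * N + 2 * (N * (((j:ℝ) + 1) * (2 * N) ^ j) + (2 * τ) ^ j *
          (τ * ∑ m ∈ Finset.Icc 1 ((j + 2) * N * M), FF N (m * β))) := by linarith
      _ ≤ 2 * ((2 * (N:ℝ)) ^ j * N) + 2 * (N * (((j:ℝ) + 1) * (2 * N) ^ j) + (2 * τ) ^ j *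
          (τ * ∑ m ∈ Finset.Icc 1 ((j + 2) * N * M), FF N (m * β))) := by linarith
      _ = _ := by push_cast; ring

open Polynomial in
lemma fsum_eq (j : ℕ) (α : Fin (j + 1) → ℝ) (X : ℝ) : ∃ P : ℝ[X], P.natDegree ≤ j + 1 ∧
    P.coeff (j + 1) = α ⟨j, by omega⟩ ∧
    fsum (j + 1) α X = ∑ n ∈ Finset.Icc (1:ℤ) ⌊X⌋₊, ee (P.eval (n:ℝ)) := by
  refine ⟨∑ i : Fin (j + 1), C (α i) * Polynomial.X ^ ((i:ℕ) + 1), ?_, ?_, ?_⟩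
  · apply natDegree_sum_le_of_forall_le
    intro i _
    refine (natDegree_C_mul_X_pow_le _ _).trans ?_
    omega
  · rw [finsetSum_coeff, Finset.sum_eq_single (⟨j, by omega⟩ : Fin (j+1))]
    · simp
    · intro b _ hb
      rw [coeff_C_mul, coeff_X_pow, if_neg, mul_zero]
      intro h
      apply hb
      ext
      simp only
      omega
    · simp
  · have : Finset.Icc (1:ℤ) ⌊X⌋₊ = (Finset.Icc 1 ⌊X⌋₊).image (fun n : ℕ => (n:ℤ)) := by
      ext x
      simp only [Finset.mem_image, Finset.mem_Icc]
      constructor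
      · intro h; exact ⟨x.toNat, by omega, by omega⟩
      · rintro ⟨n, h, rfl⟩; omega
    rw [this, Finset.sum_image (fun x _ y _ h => by simpa using h)]
    unfold fsum ee
    apply Finset.sum_congr rfl
    intro n _
    rw [eval_finsetSum]
    simp

lemma mid (j : ℕ) (hj : 1 ≤ j) (α : Fin (j + 1) → ℝ) (a : ℤ) (q : ℕ) (hq : 0 < q)
    (ha : Int.gcd a q = 1) (hα : |α ⟨j, by omega⟩ - (a:ℝ) / q| ≤ ((q:ℝ) ^ 2)⁻¹) (X : ℝ) (hX : 1 ≤ X)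
    (τ : ℝ) (hτ0 : 0 ≤ τ)
    (hτ : ∀ m : ℕ, m ≠ 0 → m ≤ (j + 1).factorial * ⌊X⌋₊ ^ j → ((m.divisors.card : ℕ):ℝ) ≤ τ) :
    ‖fsum (j + 1) α X‖ ^ (2 ^ j) ≤ (2 * X) ^ (2 ^ j) *
      (((q:ℝ)⁻¹ + X⁻¹ + q * (X ^ (j + 1))⁻¹) *
        (((j:ℝ) + 1) + (2 * τ) ^ j * (6 * (1 + Real.log q) * (j + 1).factorial))) := by
  obtain ⟨P, hP1, hP2, hP3⟩ := fsum_eq j α X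
  rw [hP3]
  set N := ⌊X⌋₊ with hN
  have hN1 : 1 ≤ N := Nat.le_floor (by simpa using hX)
  have hNX : (N:ℝ) ≤ X := Nat.floor_le (by linarith)
  have hXN : X ≤ 2 * N := by
    have := Nat.lt_floor_add_one X
    have h1 : (1:ℝ) ≤ N := by exact_mod_cast hN1
    rw [← hN] at this
    linarith
  have hN0 : (0:ℝ) < N := by exact_mod_cast hN1
  have hN1' : (1:ℝ) ≤ N := by exact_mod_cast hN1
  have hX0 : 0 < X := by linarith
  have hq0 : (0:ℝ) < q := by exact_mod_cast hq
  have hw := weyl_diff N j P hP1 1 N (by omega)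
  have hg := GG_main N τ hτ0 _ hτ hN1 j le_rfl (P.coeff (j + 1))
  have hb := blocks N q hq a ha (P.coeff (j + 1)) (by rw [hP2]; exact hα) ((j + 1).factorial * N ^ j)
  set S := ‖∑ n ∈ Finset.Icc (1:ℤ) N, ee (P.eval (n:ℝ))‖
  set c := P.coeff (j + 1)
  set L := 1 + Real.log q with hL
  have hL1 : 1 ≤ L := by have := Real.log_natCast_nonneg q; linarith
  set f : ℝ := ((j + 1).factorial : ℝ) with hf
  have hf1 : 1 ≤ f := by rw [hf]; exact_mod_cast Nat.succ_le_of_lt (Nat.factorial_pos _)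
  push_cast at hb
  rw [← hf] at hb
  set Q := (q:ℝ)⁻¹ + X⁻¹ + q * (X ^ (j + 1))⁻¹ with hQ
  -- pieces
  have p1 : (N:ℝ) ^ j ≤ N ^ (j + 1) * (2 * X⁻¹) := by
    rw [pow_succ, mul_assoc]
    have : 1 ≤ (N:ℝ) * (2 * X⁻¹) := by
      rw [← mul_assoc, ← div_eq_mul_inv, le_div_iff₀ hX0]; linarith
    exact le_mul_of_one_le_right (by positivity) this
  have p2 : (N:ℝ) ≤ N ^ j := le_self_pow₀ hN1' (by omega)
  have p3 : (q:ℝ) ≤ N ^ (j + 1) * (2 ^ (j + 1) * (q * (X ^ (j + 1))⁻¹)) := by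
    have : X ^ (j + 1) ≤ (2 * N) ^ (j + 1) := by gcongr
    rw [mul_pow] at this
    have h2 : N ^ (j + 1) * (2 ^ (j + 1) * (q * (X ^ (j + 1))⁻¹)) =
      (q:ℝ) * ((2 ^ (j + 1) * N ^ (j + 1)) / X ^ (j + 1)) := by rw [div_eq_mul_inv]; ring
    rw [h2]
    apply le_mul_of_one_le_right hq0.le
    rwa [one_le_div (by positivity)]
  have h4 : (4:ℝ) ≤ 2 ^ (j + 1) := by
    calc (4:ℝ) = 2 ^ (1 + 1) := by norm_num
      _ ≤ _ := pow_le_pow_right₀ (by norm_num) (by omega)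
  have p4 : ((N:ℝ) ^ j / q + 1) * (N + q) ≤ N ^ (j + 1) * (2 ^ (j + 1) * Q) := by
    have e : ((N:ℝ) ^ j / q + 1) * (N + q) = N ^ (j + 1) * (q:ℝ)⁻¹ + N ^ j + N + q := by
      field_simp; ring
    rw [e]
    have h5 : (N:ℝ) ^ (j + 1) * (q:ℝ)⁻¹ ≤ N ^ (j + 1) * (2 ^ (j + 1) * (q:ℝ)⁻¹) := by
      gcongr
      exact le_mul_of_one_le_left (by positivity) (by linarith)
    have h6 : (N:ℝ) ^ (j + 1) * (4 * X⁻¹) ≤ N ^ (j + 1) * (2 ^ (j + 1) * X⁻¹) := by gcongr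
    rw [hQ]
    linarith
  have p5 : (f * N ^ j / q + 1) * (6 * N + q * L) ≤ 6 * L * f * (((N:ℝ) ^ j / q + 1) * (N + q)) := by
    have h5 : f * N ^ j / q + 1 ≤ f * ((N:ℝ) ^ j / q + 1) := by
      have : f * ((N:ℝ) ^ j / q + 1) = f * N ^ j / q + f := by ring
      rw [this]; linarith
    have h6 : 6 * N + q * L ≤ 6 * L * ((N:ℝ) + q) := by
      nlinarith [mul_nonneg hq0.le (by linarith : 0 ≤ L), mul_le_mul_of_nonneg_left hL1 hN0.le]
    calc _ ≤ (f * ((N:ℝ) ^ j / q + 1)) * (6 * L * ((N:ℝ) + q)) := by gcongr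
      _ = _ := by ring
  have hQ0 : 0 < Q := by positivity
  have hG : GG N j c ≤ (2 * (N:ℝ)) ^ (j + 1) * (Q * (((j:ℝ) + 1) + (2 * τ) ^ j * (6 * L * f))) := by
    have hXQ : X⁻¹ ≤ Q := by
      have : 0 ≤ (q:ℝ)⁻¹ := by positivity
      have : 0 ≤ (q:ℝ) * (X ^ (j + 1))⁻¹ := by positivity
      linarith
    have a1 : ((j:ℝ) + 1) * (2 * N) ^ j ≤ ((j:ℝ) + 1) * ((2 * N) ^ (j + 1) * Q) := by
      gcongr
      calc (2 * (N:ℝ)) ^ j = 2 ^ j * N ^ j := by rw [mul_pow]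
        _ ≤ 2 ^ j * (N ^ (j + 1) * (2 * X⁻¹)) := by gcongr
        _ = (2 * N) ^ (j + 1) * X⁻¹ := by rw [mul_pow]; ring
        _ ≤ _ := by gcongr
    have a2 : (2 * τ) ^ j * ∑ m ∈ Finset.Icc 1 ((j + 1).factorial * N ^ j), FF N (m * c) ≤
        (2 * τ) ^ j * (6 * L * f * (N ^ (j + 1) * (2 ^ (j + 1) * Q))) := by
      apply mul_le_mul_of_nonneg_left _ (by positivity)
      refine hb.trans (p5.trans ?_)
      gcongr
    refine hg.trans ((add_le_add a1 a2).trans (le_of_eq ?_))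
    rw [mul_pow 2 (N:ℝ) (j+1)]; ring
  set D := ((j:ℝ) + 1) + (2 * τ) ^ j * (6 * L * f)
  have hD : 0 ≤ D := by positivity
  have h7 : (2 * (N:ℝ)) ^ (j + 1) * S ^ (2 ^ j) ≤ (2 * (N:ℝ)) ^ (j + 1) * ((2 * N) ^ (2 ^ j) * (Q * D)) := by
    refine hw.trans ?_
    calc _ ≤ (2 * (N:ℝ)) ^ (2 ^ j) * ((2 * (N:ℝ)) ^ (j + 1) * (Q * D)) := by gcongr
      _ = _ := by ring
  refine (le_of_mul_le_mul_left h7 (by positivity)).trans ?_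
  gcongr

theorem weyl_inequality (k : ℕ) (hk : 2 ≤ k) (ε : ℝ) (hε : ε > 0) :
    ∃ C : ℝ, ∀ (α : Fin k → ℝ) (a : ℤ) (q : ℕ),
      0 < q → Int.gcd a q = 1 →
      |α ⟨k - 1, by omega⟩ - (a : ℝ) / q| ≤ ((q : ℝ) ^ 2)⁻¹ →
      ∀ X : ℝ, X ≥ 1 →
        ‖fsum k α X‖ ≤
          C * X ^ (1 + ε) *
            ((q : ℝ)⁻¹ + X⁻¹ + (q : ℝ) * X ^ (-(k : ℝ))) ^ ((2 : ℝ) ^ (1 - (k : ℝ))) := by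
  obtain ⟨j, rfl⟩ : ∃ j, k = j + 1 := ⟨k - 1, by omega⟩
  have hj : 1 ≤ j := by omega
  have hj0 : (0:ℝ) < j := by exact_mod_cast hj
  set ε' : ℝ := ε * 2 ^ j with hε'
  have hε'0 : 0 < ε' := by positivity
  set δ : ℝ := ε' / (2 * j * j) with hδ
  have hδ0 : 0 < δ := by positivity
  obtain ⟨A, hA1, hA⟩ := divisor_bound δ hδ0
  set f : ℝ := ((j + 1).factorial : ℝ) with hf
  have hf0 : 0 < f := by rw [hf]; exact_mod_cast Nat.factorial_pos _
  set C1 : ℝ := ((j:ℝ) + 1) + (2 * (A * f ^ δ)) ^ j * (6 * (1 + (j + 1) * (2 / ε')) * f) with hC1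
  have hC10 : 0 < C1 := by positivity
  set η : ℝ := (2 : ℝ) ^ (1 - ((j + 1 : ℕ) : ℝ)) with hη
  have hη0 : 0 < η := by positivity
  have hηE : ((2 ^ j : ℕ) : ℝ) * η = 1 := by
    rw [hη]; push_cast
    rw [← Real.rpow_natCast, ← Real.rpow_add (by norm_num)]
    have : (j:ℝ) + (1 - (j + 1)) = 0 := by ring
    rw [this, Real.rpow_zero]
  refine ⟨1 + 2 * C1 ^ η, ?_⟩
  intro α a q hq ha hα X hX
  have hX0 : 0 < X := by linarith
  have hq0 : (0:ℝ) < q := by exact_mod_cast hq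
  have hXk : X ^ (-((j + 1 : ℕ) : ℝ)) = (X ^ (j + 1))⁻¹ := by
    rw [Real.rpow_neg hX0.le, Real.rpow_natCast]
  rw [hXk]
  set Q := (q:ℝ)⁻¹ + X⁻¹ + q * (X ^ (j + 1))⁻¹ with hQ
  have hQ0 : 0 < Q := by positivity
  have hC1η : 0 < C1 ^ η := by positivity
  have hXε : X ≤ X ^ (1 + ε) := by
    conv_lhs => rw [← Real.rpow_one X]
    exact Real.rpow_le_rpow_of_exponent_le hX (by linarith)
  rcases lt_or_ge (X ^ (j + 1)) (q:ℝ) with hbig | hsmall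
  · have hQ1 : 1 ≤ Q := by
      have : 1 ≤ (q:ℝ) * (X ^ (j + 1))⁻¹ := by
        rw [← div_eq_mul_inv, one_le_div (by positivity)]; exact hbig.le
      have : 0 < (q:ℝ)⁻¹ := by positivity
      have : 0 < X⁻¹ := by positivity
      linarith
    have h1 : ‖fsum (j + 1) α X‖ ≤ X := by
      obtain ⟨P, _, _, h⟩ := fsum_eq j α X
      rw [h]
      exact (norm_sum_le_N _ (fun n => ee_norm _) _ _ ⌊X⌋₊ (by omega)).trans (Nat.floor_le hX0.le)
    have h2 : 1 ≤ Q ^ η := Real.one_le_rpow hQ1 hη0.le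
    calc ‖fsum (j + 1) α X‖ ≤ X ^ (1 + ε) := h1.trans hXε
      _ ≤ (1 + 2 * C1 ^ η) * X ^ (1 + ε) :=
        le_mul_of_one_le_left (by positivity) (by linarith)
      _ ≤ _ := le_mul_of_one_le_right (by positivity) h2
  · set τ : ℝ := A * f ^ δ * X ^ (j * δ) with hτ
    have hm := mid j hj α a q hq ha hα X hX τ (by positivity) (by
      intro m hm hmle
      refine (hA m hm).trans ?_
      have h1 : (m:ℝ) ≤ f * X ^ j := by
        calc (m:ℝ) ≤ (((j + 1).factorial * ⌊X⌋₊ ^ j : ℕ) : ℝ) := by exact_mod_cast hmle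
          _ = f * (⌊X⌋₊ : ℝ) ^ j := by push_cast; rfl
          _ ≤ _ := by
            gcongr
            exact Nat.floor_le hX0.le
      rw [hτ, mul_assoc]
      apply mul_le_mul_of_nonneg_left _ (by linarith)
      calc (m:ℝ) ^ δ ≤ (f * X ^ j) ^ δ := by gcongr
        _ = _ := by
          rw [Real.mul_rpow hf0.le (by positivity), ← Real.rpow_natCast X j, ← Real.rpow_mul hX0.le])
    have hτj : (2 * τ) ^ j = (2 * (A * f ^ δ)) ^ j * X ^ (ε' / 2) := by
      have : 2 * τ = 2 * (A * f ^ δ) * X ^ (j * δ) := by rw [hτ]; ring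
      rw [this, mul_pow, ← Real.rpow_natCast (X ^ (j * δ)) j, ← Real.rpow_mul hX0.le]
      congr 2
      rw [hδ]; field_simp
    have hXh : 1 ≤ X ^ (ε' / 2) := Real.one_le_rpow hX (by positivity)
    have hL : 1 + Real.log q ≤ (1 + (j + 1) * (2 / ε')) * X ^ (ε' / 2) := by
      have h1 : Real.log q ≤ (j + 1) * Real.log X := by
        calc Real.log q ≤ Real.log (X ^ (j + 1)) := Real.log_le_log hq0 hsmall
          _ = _ := by rw [Real.log_pow]; push_cast; ring
      have h2 := Real.log_le_rpow_div hX0.le (by positivity : 0 < ε' / 2)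
      have h3 : X ^ (ε' / 2) / (ε' / 2) = 2 / ε' * X ^ (ε' / 2) := by field_simp
      rw [h3] at h2
      have h4 : ((j:ℝ) + 1) * Real.log X ≤ (j + 1) * (2 / ε' * X ^ (ε' / 2)) := by gcongr
      linarith
    have hXX : X ^ (ε' / 2) * X ^ (ε' / 2) = X ^ ε' := by
      rw [← Real.rpow_add hX0]; congr 1; ring
    have hXe1 : 1 ≤ X ^ ε' := Real.one_le_rpow hX hε'0.le
    have hD : ((j:ℝ) + 1) + (2 * τ) ^ j * (6 * (1 + Real.log q) * f) ≤ C1 * X ^ ε' := by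
      rw [hτj]
      have h1 : (2 * (A * f ^ δ)) ^ j * X ^ (ε' / 2) * (6 * (1 + Real.log q) * f) ≤
          (2 * (A * f ^ δ)) ^ j * X ^ (ε' / 2) *
            (6 * ((1 + (j + 1) * (2 / ε')) * X ^ (ε' / 2)) * f) := by gcongr
      have h2 : (2 * (A * f ^ δ)) ^ j * X ^ (ε' / 2) *
            (6 * ((1 + (j + 1) * (2 / ε')) * X ^ (ε' / 2)) * f) =
          (2 * (A * f ^ δ)) ^ j * (6 * (1 + (j + 1) * (2 / ε')) * f) * X ^ ε' := by
        rw [← hXX]; ring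
      have h3 : ((j:ℝ) + 1) ≤ (j + 1) * X ^ ε' := le_mul_of_one_le_right (by positivity) hXe1
      rw [hC1, add_mul]
      linarith
    have hfin : ‖fsum (j + 1) α X‖ ^ (2 ^ j) ≤ (2 * X) ^ (2 ^ j) * (Q * (C1 * X ^ ε')) := by
      refine hm.trans ?_
      gcongr
    have hroot := Real.rpow_le_rpow (by positivity) hfin hη0.le
    have e1 : ∀ y : ℝ, 0 ≤ y → (y ^ (2 ^ j)) ^ η = y := by
      intro y hy
      rw [← Real.rpow_natCast, ← Real.rpow_mul hy, hηE, Real.rpow_one]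
    have e2 : (X ^ ε') ^ η = X ^ ε := by
      rw [← Real.rpow_mul hX0.le]
      congr 1
      rw [hε', mul_assoc]
      push_cast at hηE
      rw [hηE, mul_one]
    rw [e1 _ (norm_nonneg _), Real.mul_rpow (by positivity) (by positivity), e1 _ (by positivity),
      Real.mul_rpow hQ0.le (by positivity), Real.mul_rpow hC10.le (by positivity), e2] at hroot
    refine hroot.trans ?_
    rw [Real.rpow_add hX0, Real.rpow_one]
    have : 0 ≤ X * X ^ ε * Q ^ η := by positivity
    have e3 : 2 * X * (Q ^ η * (C1 ^ η * X ^ ε)) = 2 * C1 ^ η * (X * X ^ ε * Q ^ η) := by ring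
    rw [e3]
    have e4 : (1 + 2 * C1 ^ η) * (X * X ^ ε) * Q ^ η =
        X * X ^ ε * Q ^ η + 2 * C1 ^ η * (X * X ^ ε * Q ^ η) := by ring
    rw [e4]
    exact le_add_of_nonneg_left this
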